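/- The simplified Bouchut–Boyaval system is of Rich type: for all i, j, k ∈ {1,2,3} with j ≠ i and k ≠ i (and j ≠ k), ∂/∂R_j [ (∂λᵢ/∂R_k)/(λ_k - λᵢ) ] = ∂/∂R_k [ (∂λᵢ/∂R_j)/(λ_j - λᵢ) ] holds at every point where λ₁, λ₂, λ₃ are pairwise distinct. -/

import Mathlib

/-- The eigenvalues of the simplified Bouchut–Boyaval system as functions of the
Riemann invariants `(R₁, R₂, R₃)`. -/
noncomputable def sBBlam (s : ℝ) : Fin 3 → ℝ → ℝ → ℝ → ℝ
  | 0, _, R2, R3 => R3 / s - s * R2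
  | 1, R1, _, R3 => (R3 - R1) / (2 * s)
  | 2, R1, R2, _ => s * R2 - R1 / s

/-- Partial derivative with respect to the j-th Riemann invariant. -/
noncomputable def sBBpd : Fin 3 → (ℝ → ℝ → ℝ → ℝ) → ℝ → ℝ → ℝ → ℝ
  | 0, f, x, y, z => deriv (fun t => f t y z) x
  | 1, f, x, y, z => deriv (fun t => f x t z) y
  | 2, f, x, y, z => deriv (fun t => f x y t) z

/-- The spectral gap `λ₃ - λ₁`, of which all eigenvalue differences are multiples. -/
noncomputable def sBBgap (s a b c : ℝ) : ℝ := 2 * s * b - (a + c) / s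

theorem sBBlam_two_sub_zero (s a b c : ℝ) :
    sBBlam s 2 a b c - sBBlam s 0 a b c = sBBgap s a b c := by
  simp only [sBBlam, sBBgap]; ring

theorem sBBlam_one_sub_zero (s a b c : ℝ) :
    sBBlam s 1 a b c - sBBlam s 0 a b c = sBBgap s a b c / 2 := by
  simp only [sBBlam, sBBgap]; ring

theorem sBBlam_two_sub_one (s a b c : ℝ) :
    sBBlam s 2 a b c - sBBlam s 1 a b c = sBBgap s a b c / 2 := by
  simp only [sBBlam, sBBgap]; ring

theorem sBBlam_zero_sub_two (s a b c : ℝ) :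
    sBBlam s 0 a b c - sBBlam s 2 a b c = -sBBgap s a b c := by
  simp only [sBBlam, sBBgap]; ring

theorem sBBlam_zero_sub_one (s a b c : ℝ) :
    sBBlam s 0 a b c - sBBlam s 1 a b c = -(sBBgap s a b c / 2) := by
  simp only [sBBlam, sBBgap]; ring

theorem sBBlam_one_sub_two (s a b c : ℝ) :
    sBBlam s 1 a b c - sBBlam s 2 a b c = -(sBBgap s a b c / 2) := by
  simp only [sBBlam, sBBgap]; ring

theorem hasDerivAt_sBBgap_fst (s a b c : ℝ) :
    HasDerivAt (fun t => sBBgap s t b c) (-(1 / s)) a :=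
  (((hasDerivAt_id a).add_const c).div_const s).const_sub (2 * s * b)

theorem hasDerivAt_sBBgap_snd (s a b c : ℝ) :
    HasDerivAt (fun t => sBBgap s a t c) (2 * s) b := by
  simpa only [sBBgap, mul_one] using
    ((hasDerivAt_id' b).const_mul (2 * s)).sub_const ((a + c) / s)

theorem hasDerivAt_sBBgap_thd (s a b c : ℝ) :
    HasDerivAt (fun t => sBBgap s a b t) (-(1 / s)) c :=
  (((hasDerivAt_id c).const_add a).div_const s).const_sub (2 * s * b)

theorem deriv_const_div_of_hasDerivAt {f : ℝ → ℝ} {f' x : ℝ} (k : ℝ) (hf : HasDerivAt f f' x)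
    (hx : f x ≠ 0) : deriv (fun t => k / f t) x = -(k * f') / f x ^ 2 := by
  simpa using ((hasDerivAt_const x k).fun_div hf hx).deriv

/-- The Jacobian matrix of the eigenvalues. -/
theorem sBBpd_sBBlam (s : ℝ) (i j : Fin 3) (a b c : ℝ) :
    sBBpd j (sBBlam s i) a b c =
      !![0, -s, 1 / s; -(1 / (2 * s)), 0, 1 / (2 * s); -(1 / s), s, 0] i j := by
  fin_cases i <;> fin_cases j <;>
    simp [sBBpd, sBBlam, deriv_const_sub, deriv_sub_const, neg_div]

/-- the simplified Bouchut–Boyaval system is of Rich type: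
for i, j, k ∈ {1,2,3} with j ≠ i, k ≠ i (and j ≠ k),
∂/∂R_j [ (∂λᵢ/∂R_k)/(λ_k − λᵢ) ] = ∂/∂R_k [ (∂λᵢ/∂R_j)/(λ_j − λᵢ) ]
at every point where λ₁, λ₂, λ₃ are pairwise distinct. -/
theorem sBB_rich_type (s : ℝ) (hs : 0 < s) :
    ∀ i j k : Fin 3, j ≠ i → k ≠ i → j ≠ k →
    ∀ x y z : ℝ,
      sBBlam s 0 x y z ≠ sBBlam s 1 x y z →
      sBBlam s 0 x y z ≠ sBBlam s 2 x y z →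
      sBBlam s 1 x y z ≠ sBBlam s 2 x y z →
      sBBpd j (fun a b c => sBBpd k (sBBlam s i) a b c /
          (sBBlam s k a b c - sBBlam s i a b c)) x y z =
      sBBpd k (fun a b c => sBBpd j (sBBlam s i) a b c /
          (sBBlam s j a b c - sBBlam s i a b c)) x y z := by
  intro i j k hji hki hjk x y z _ h02 _
  have hs0 : s ≠ 0 := hs.ne'
  have hgap : sBBgap s x y z ≠ 0 := by
    rw [← sBBlam_two_sub_zero]
    exact sub_ne_zero.mpr h02.symm
  have quot_half : ∀ m d : ℝ, m / (d / 2) = 2 * m / d := fun m d => by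
    rw [div_div_eq_mul_div, mul_comm]
  have h1 := fun m => deriv_const_div_of_hasDerivAt m (hasDerivAt_sBBgap_fst s x y z) hgap
  have h2 := fun m => deriv_const_div_of_hasDerivAt m (hasDerivAt_sBBgap_snd s x y z) hgap
  have h3 := fun m => deriv_const_div_of_hasDerivAt m (hasDerivAt_sBBgap_thd s x y z) hgap
  simp only [sBBpd_sBBlam]
  fin_cases i <;> fin_cases j <;> fin_cases k <;> first
    | exact absurd rfl hji
    | exact absurd rfl hki
    | exact absurd rfl hjk
    | simp only [Fin.mk_zero, Fin.mk_one, Fin.reduceFinMk,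
        sBBlam_two_sub_zero, sBBlam_one_sub_zero, sBBlam_two_sub_one,
        sBBlam_zero_sub_two, sBBlam_zero_sub_one, sBBlam_one_sub_two,
        div_neg, ← neg_div, quot_half, sBBpd, h1, h2, h3]
      simp
      field_simp
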